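/- For every real q with 0 < q < 1, the generalized continued fraction 1/(1 + (q + q²)/(1 + (q² + q⁴)/(1 + (q³ + q⁶)/(1 + ⋯)))) — with b₀ = 0, all partial denominators 1, first partial numerator 1, and n-th partial numerator q^{n−1} + q^{2(n−1)} for n ≥ 2 — converges, and its value equals ∏_{n=1}^∞ [(1 − q^{6n−5})(1 − q^{6n−1})] / (1 − q^{6n−3})². -/

import Mathlib

/-- Ramanujan's cubic generalized continued fraction
`1/(1 + (q + q²)/(1 + (q² + q⁴)/(1 + (q³ + q⁶)/(1 + ⋯))))`:
head term `0`, all partial denominators `1`, first partial numerator `1`, and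
`n`-th partial numerator `q^{n-1} + q^{2(n-1)}` for `n ≥ 2`. -/
noncomputable def cubicGCF (q : ℝ) : GenContFract ℝ :=
  ⟨0, Stream'.Seq.ofStream (fun n : ℕ =>
    ⟨if n = 0 then 1 else q ^ n + q ^ (2 * n), 1⟩)⟩

open Finset Filter Topology

/-- The Gaussian binomial coefficient, defined through the `Q`-Pascal rule. -/
def gaussBinom (Q : ℝ) : ℕ → ℕ → ℝ
  | _, 0 => 1
  | 0, _ + 1 => 0
  | n + 1, k + 1 => gaussBinom Q n k + Q ^ (k + 1) * gaussBinom Q n (k + 1)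

/-- The finite `Q`-Pochhammer symbol `(Q; Q)_n`. -/
def qFactorial (Q : ℝ) (n : ℕ) : ℝ := ∏ i ∈ range n, (1 - Q ^ (i + 1))

theorem gaussBinom_zero_right (Q : ℝ) (n : ℕ) : gaussBinom Q n 0 = 1 := by
  cases n <;> rfl

theorem gaussBinom_eq_zero_of_lt (Q : ℝ) {n k : ℕ} (h : n < k) : gaussBinom Q n k = 0 := by
  induction n generalizing k with
  | zero => cases k with
    | zero => omega
    | succ k => rfl
  | succ n ih => cases k with
    | zero => omega
    | succ k => simp [gaussBinom, ih (show n < k by omega), ih (show n < k + 1 by omega)]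

theorem gaussBinom_add_mul_qFactorial (Q : ℝ) (a b : ℕ) :
    gaussBinom Q (a + b) a * qFactorial Q a * qFactorial Q b = qFactorial Q (a + b) := by
  induction hn : a + b generalizing a b with
  | zero =>
    obtain ⟨rfl, rfl⟩ : a = 0 ∧ b = 0 := by omega
    simp [gaussBinom, qFactorial]
  | succ n ih =>
    cases a with
    | zero =>
      obtain rfl : b = n + 1 := by omega
      simp [gaussBinom, qFactorial]
    | succ a =>
      have hF (m : ℕ) : qFactorial Q (m + 1) = qFactorial Q m * (1 - Q ^ (m + 1)) :=
        prod_range_succ _ _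
      have h1 := ih a b (by omega)
      rw [gaussBinom, hF n, hF a]
      cases b with
      | zero =>
        obtain rfl : a = n := by omega
        rw [gaussBinom_eq_zero_of_lt Q (Nat.lt_succ_self a)]
        linear_combination (1 - Q ^ (a + 1)) * h1
      | succ b =>
        have h2 := ih (a + 1) b (by omega)
        obtain rfl : n = a + b + 1 := by omega
        rw [hF a] at h2
        rw [hF b] at h1 ⊢
        linear_combination (1 - Q ^ (a + 1)) * h1 + Q ^ (a + 1) * (1 - Q ^ (b + 1)) * h2

/-- The homogeneous `Q`-binomial theorem. -/
theorem prod_add_mul_pow_eq_sum_gaussBinom (r x y : ℝ) (M : ℕ) :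
    ∏ k ∈ range M, (y + x * r ^ (2 * k + 1)) =
      ∑ m ∈ range (M + 1), gaussBinom (r ^ 2) M m * r ^ (m ^ 2) * x ^ m * y ^ (M - m) := by
  induction M generalizing x with
  | zero => simp [gaussBinom]
  | succ M ih =>
    have hshift : ∏ k ∈ range M, (y + x * r ^ (2 * (k + 1) + 1)) =
        ∑ m ∈ range (M + 1),
          gaussBinom (r ^ 2) M m * r ^ (m ^ 2) * (x * r ^ 2) ^ m * y ^ (M - m) := by
      rw [← ih]
      exact prod_congr rfl fun k _ => by ring
    rw [prod_range_succ', hshift, mul_add, sum_range_succ' _ (M + 1)]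
    have hlow : (∑ m ∈ range (M + 1),
        gaussBinom (r ^ 2) M m * r ^ (m ^ 2) * (x * r ^ 2) ^ m * y ^ (M - m)) * y =
        ∑ m ∈ range (M + 1), gaussBinom (r ^ 2) M (m + 1) * r ^ ((m + 1) ^ 2) *
          (x * r ^ 2) ^ (m + 1) * y ^ (M - m) + y ^ (M + 1) := by
      rw [sum_range_succ', sum_range_succ, gaussBinom_eq_zero_of_lt _ (Nat.lt_succ_self M),
        add_mul, sum_mul]
      simp only [gaussBinom_zero_right]
      congr 1
      · simp only [zero_mul, add_zero]
        refine sum_congr rfl fun m hm => ?_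
        have : M - m = M - (m + 1) + 1 := by have := mem_range.1 hm; omega
        rw [this]; ring
      · simp [pow_succ]
    rw [hlow, sum_mul, add_right_comm, ← sum_add_distrib]
    congr 1
    · refine sum_congr rfl fun m _ => ?_
      rw [gaussBinom, show M + 1 - (m + 1) = M - m by omega]
      ring
    · simp [gaussBinom_zero_right]

/-- The finite form of the Jacobi triple product identity. -/
theorem finite_jacobi_triple_product {r z w : ℝ} (hr : r ≠ 0) (hzw : z * w = 1) (N : ℕ) :
    ∏ i ∈ range N, ((1 - z * r ^ (2 * i + 1)) * (1 - w * r ^ (2 * i + 1))) =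
      ∑ j ∈ range (N + 1), gaussBinom (r ^ 2) (2 * N) (N + j) * ((-z) ^ j * r ^ (j ^ 2)) +
      ∑ j ∈ range N,
        gaussBinom (r ^ 2) (2 * N) (N - 1 - j) * ((-w) ^ (j + 1) * r ^ ((j + 1) ^ 2)) := by
  have hz : z ≠ 0 := left_ne_zero_of_mul_eq_one hzw
  have hc : (-z) ^ N * r ^ (3 * N ^ 2) ≠ 0 :=
    mul_ne_zero (pow_ne_zero _ (neg_ne_zero.2 hz)) (pow_ne_zero _ hr)
  refine mul_left_cancel₀ hc ?_
  have hcauchy := prod_add_mul_pow_eq_sum_gaussBinom r (-z) (r ^ (2 * N)) (2 * N)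
  have hprod : ∏ k ∈ range (2 * N), (r ^ (2 * N) + -z * r ^ (2 * k + 1)) =
      (-z) ^ N * r ^ (3 * N ^ 2) *
        ∏ i ∈ range N, ((1 - z * r ^ (2 * i + 1)) * (1 - w * r ^ (2 * i + 1))) := by
    have hlow : ∏ k ∈ range N, (r ^ (2 * N) + -z * r ^ (2 * k + 1)) =
        (-z) ^ N * r ^ (N ^ 2) * ∏ i ∈ range N, (1 - w * r ^ (2 * i + 1)) := by
      have hpow : ∀ n : ℕ, ∏ i ∈ range n, (-z * r ^ (2 * i + 1)) = (-z) ^ n * r ^ (n ^ 2) := by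
        intro n
        induction n with
        | zero => simp
        | succ n ih => rw [prod_range_succ, ih]; ring
      rw [← hpow, ← prod_range_reflect (fun i => 1 - w * r ^ (2 * i + 1)), ← prod_mul_distrib]
      refine prod_congr rfl fun k hk => ?_
      have hk := mem_range.1 hk
      rw [show r ^ (2 * N) = r ^ (2 * k + 1) * r ^ (2 * (N - 1 - k) + 1) by
        rw [← pow_add]; congr 1; omega]
      linear_combination (-(r ^ (2 * k + 1) * r ^ (2 * (N - 1 - k) + 1))) * hzw
    have hhigh : ∏ k ∈ range N, (r ^ (2 * N) + -z * r ^ (2 * (N + k) + 1)) =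
        r ^ (2 * N ^ 2) * ∏ i ∈ range N, (1 - z * r ^ (2 * i + 1)) := by
      rw [show r ^ (2 * N ^ 2) = ∏ i ∈ range N, r ^ (2 * N) by
        rw [prod_const, card_range]; ring, ← prod_mul_distrib]
      exact prod_congr rfl fun k _ => by ring
    rw [two_mul, prod_range_add, ← two_mul, hlow, hhigh, prod_mul_distrib]
    ring
  rw [← hprod, hcauchy, show 2 * N + 1 = N + (N + 1) by ring, sum_range_add, mul_add,
    add_comm, mul_sum, mul_sum]
  congr 1
  · refine sum_congr rfl fun j hj => ?_
    obtain ⟨d, rfl⟩ : ∃ d, N = j + d := Nat.exists_eq_add_of_le (by have := mem_range.1 hj; omega)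
    rw [show 2 * (j + d) - (j + d + j) = d by omega]
    ring
  · rw [← sum_range_reflect]
    refine sum_congr rfl fun j hj => ?_
    obtain ⟨d, rfl⟩ : ∃ d, N = d + (j + 1) :=
      ⟨N - (j + 1), by have := mem_range.1 hj; omega⟩
    rw [show d + (j + 1) - 1 - j = d by omega,
      show 2 * (d + (j + 1)) - d = d + 2 * (j + 1) by omega]
    have h : (-z) ^ (d + (j + 1)) * (-w) ^ (j + 1) = (-z) ^ d := by
      rw [pow_add, mul_assoc, ← mul_pow, neg_mul_neg, hzw, one_pow, mul_one]
    rw [← h]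
    ring

theorem qFactorial_pos {Q : ℝ} (h0 : 0 ≤ Q) (h1 : Q < 1) (n : ℕ) : 0 < qFactorial Q n :=
  prod_pos fun _ _ => sub_pos.2 (pow_lt_one₀ h0 h1 (Nat.succ_ne_zero _))

theorem qFactorial_antitone {Q : ℝ} (h0 : 0 ≤ Q) (h1 : Q < 1) : Antitone (qFactorial Q) := by
  refine antitone_nat_of_succ_le fun n => ?_
  rw [qFactorial, prod_range_succ]
  exact mul_le_of_le_one_right (qFactorial_pos h0 h1 n).le (sub_le_self _ (by positivity))

theorem exists_tendsto_qFactorial {Q : ℝ} (h0 : 0 ≤ Q) (h1 : Q < 1) :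
    ∃ L : ℝ, 0 < L ∧ Tendsto (qFactorial Q) atTop (𝓝 L) ∧ ∀ n, L ≤ qFactorial Q n := by
  have hs : Summable fun i : ℕ => ‖-Q ^ (i + 1)‖ := by
    simpa [abs_of_nonneg h0] using
      (summable_nat_add_iff 1).2 (summable_geometric_of_lt_one h0 h1)
  have hlim : Tendsto (qFactorial Q) atTop (𝓝 (∏' i : ℕ, (1 + -Q ^ (i + 1)))) := by
    refine (multipliable_one_add_of_summable hs).tendsto_prod_tprod_nat.congr fun n => ?_
    simp only [qFactorial, sub_eq_add_neg]
  have hle := (qFactorial_antitone h0 h1).le_of_tendsto hlim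
  refine ⟨_, ?_, hlim, hle⟩
  refine lt_of_le_of_ne (ge_of_tendsto' hlim fun n => (qFactorial_pos h0 h1 n).le) (Ne.symm ?_)
  refine tprod_one_add_ne_zero_of_summable (fun i => ?_) hs
  rw [← sub_eq_add_neg]
  exact (sub_pos.2 (pow_lt_one₀ h0 h1 (Nat.succ_ne_zero _))).ne'

theorem gaussBinom_add_eq_div {Q : ℝ} (h0 : 0 ≤ Q) (h1 : Q < 1) (a b : ℕ) :
    gaussBinom Q (a + b) a = qFactorial Q (a + b) / (qFactorial Q a * qFactorial Q b) := by
  have ha := (qFactorial_pos h0 h1 a).ne'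
  have hb := (qFactorial_pos h0 h1 b).ne'
  rw [eq_div_iff (mul_ne_zero ha hb), ← mul_assoc, gaussBinom_add_mul_qFactorial]

theorem abs_gaussBinom_le {Q L : ℝ} (h0 : 0 ≤ Q) (h1 : Q < 1) (hL : 0 < L)
    (hle : ∀ n, L ≤ qFactorial Q n) (n k : ℕ) : |gaussBinom Q n k| ≤ 1 / L ^ 2 := by
  rcases lt_or_ge n k with h | h
  · rw [gaussBinom_eq_zero_of_lt Q h, abs_zero]
    positivity
  · obtain ⟨b, rfl⟩ := Nat.exists_eq_add_of_le h
    have hone : qFactorial Q (k + b) ≤ 1 := by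
      simpa [qFactorial] using qFactorial_antitone h0 h1 (Nat.zero_le (k + b))
    rw [gaussBinom_add_eq_div h0 h1, abs_of_nonneg (div_nonneg (qFactorial_pos h0 h1 _).le
      (mul_pos (qFactorial_pos h0 h1 _) (qFactorial_pos h0 h1 _)).le), sq]
    exact div_le_div₀ zero_le_one hone (by positivity)
      (mul_le_mul (hle k) (hle b) hL.le (qFactorial_pos h0 h1 _).le)

theorem tendsto_gaussBinom {Q L : ℝ} (h0 : 0 ≤ Q) (h1 : Q < 1) (hL : 0 < L)
    (hlim : Tendsto (qFactorial Q) atTop (𝓝 L)) {n k : ℕ → ℕ} (hkn : ∀ᶠ N in atTop, k N ≤ n N)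
    (hk : Tendsto k atTop atTop) (hnk : Tendsto (fun N => n N - k N) atTop atTop) :
    Tendsto (fun N => gaussBinom Q (n N) (k N)) atTop (𝓝 (1 / L)) := by
  have hn : Tendsto n atTop atTop := tendsto_atTop_mono' _ hkn hk
  have h := (hlim.comp hn).div ((hlim.comp hk).mul (hlim.comp hnk)) (mul_pos hL hL).ne'
  rw [show L / (L * L) = 1 / L by field_simp] at h
  refine h.congr' ?_
  filter_upwards [hkn] with N hN
  obtain ⟨b, hb⟩ := Nat.exists_eq_add_of_le hN
  simp only [Function.comp_apply, Pi.div_apply, hb, Nat.add_sub_cancel_left,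
    gaussBinom_add_eq_div h0 h1]

/-- Dominated convergence for finite sums of a summable sequence with bounded,
pointwise convergent weights. -/
theorem tendsto_sum_range_mul {c : ℕ → ℕ → ℝ} {f : ℕ → ℝ} {M C : ℝ} {e : ℕ → ℕ}
    (hf : Summable fun j => ‖f j‖) (hC : ∀ N j, |c N j| ≤ C)
    (hc : ∀ j, Tendsto (fun N => c N j) atTop (𝓝 M)) (he : Tendsto e atTop atTop) :
    Tendsto (fun N => ∑ j ∈ range (e N), c N j * f j) atTop (𝓝 (M * ∑' j, f j)) := by
  have hC0 : 0 ≤ C := (abs_nonneg _).trans (hC 0 0)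
  have key := tendsto_tsum_of_dominated_convergence (𝓕 := atTop)
    (f := fun N j => if j < e N then c N j * f j else 0) (g := fun j => M * f j)
    (bound := fun j => C * ‖f j‖) (hf.mul_left C) ?_ ?_
  · rw [tsum_mul_left] at key
    refine key.congr fun N => ?_
    rw [tsum_eq_sum (s := range (e N)) (by simp +contextual)]
    exact sum_congr rfl fun j hj => if_pos (mem_range.1 hj)
  · intro j
    refine ((hc j).mul_const (f j)).congr' ?_
    filter_upwards [he.eventually_gt_atTop j] with N hN
    rw [if_pos hN]
  · refine Eventually.of_forall fun N j => ?_
    split_ifs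
    · rw [norm_mul]
      exact mul_le_mul_of_nonneg_right (hC N j) (norm_nonneg _)
    · rw [norm_zero]
      positivity

theorem norm_pow_mul_pow_sq_le {r z : ℝ} (hr0 : 0 ≤ r) (hr1 : r ≤ 1) (j : ℕ) :
    ‖(-z) ^ j * r ^ (j ^ 2)‖ ≤ (|z| * r) ^ j := by
  rw [norm_mul, norm_pow, norm_neg, Real.norm_eq_abs, Real.norm_eq_abs,
    abs_of_nonneg (pow_nonneg hr0 _), mul_pow]
  exact mul_le_mul_of_nonneg_left
    (pow_le_pow_of_le_one hr0 hr1 (Nat.le_self_pow two_ne_zero j)) (by positivity)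

theorem summable_norm_pow_mul_pow_sq {r z : ℝ} (hr0 : 0 ≤ r) (hr1 : r ≤ 1) (hz : |z| * r < 1) :
    Summable fun j : ℕ => ‖(-z) ^ j * r ^ (j ^ 2)‖ :=
  Summable.of_nonneg_of_le (fun _ => norm_nonneg _) (norm_pow_mul_pow_sq_le hr0 hr1)
    (summable_geometric_of_lt_one (by positivity) hz)

/-- The Jacobi triple product identity, for `L = (r²; r²)_∞`, with the bilateral series folded. -/
theorem jacobi_triple_product {r z w L : ℝ} (hr0 : 0 < r) (hr1 : r < 1) (hzw : z * w = 1)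
    (hz : |z| * r < 1) (hw : |w| * r < 1) (hL : 0 < L)
    (hlim : Tendsto (qFactorial (r ^ 2)) atTop (𝓝 L)) (hle : ∀ n, L ≤ qFactorial (r ^ 2) n) :
    Tendsto (fun N => ∏ i ∈ range N, ((1 - z * r ^ (2 * i + 1)) * (1 - w * r ^ (2 * i + 1))))
      atTop (𝓝 (1 / L * ∑' j : ℕ,
        ((-z) ^ j * r ^ (j ^ 2) + (-w) ^ (j + 1) * r ^ ((j + 1) ^ 2)))) := by
  have hQ0 : 0 ≤ r ^ 2 := by positivity
  have hQ1 : r ^ 2 < 1 := pow_lt_one₀ hr0.le hr1 two_ne_zero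
  have hsz := summable_norm_pow_mul_pow_sq hr0.le hr1.le hz
  have hsw : Summable fun j : ℕ => ‖(-w) ^ (j + 1) * r ^ ((j + 1) ^ 2)‖ :=
    (summable_nat_add_iff 1).2 (summable_norm_pow_mul_pow_sq hr0.le hr1.le hw)
  simp_rw [finite_jacobi_triple_product hr0.ne' hzw]
  rw [hsz.of_norm.tsum_add hsw.of_norm, mul_add]
  refine (tendsto_sum_range_mul hsz (fun _ _ => abs_gaussBinom_le hQ0 hQ1 hL hle _ _) (fun j => ?_)
    (tendsto_add_atTop_nat 1)).add
    (tendsto_sum_range_mul hsw (fun _ _ => abs_gaussBinom_le hQ0 hQ1 hL hle _ _) (fun j => ?_)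
    tendsto_id)
  · refine tendsto_gaussBinom hQ0 hQ1 hL hlim ?_ (tendsto_add_atTop_nat j) ?_
    · filter_upwards [eventually_ge_atTop j] with N hN
      omega
    · refine tendsto_atTop_mono' _ ?_ (tendsto_sub_atTop_nat j)
      exact Eventually.of_forall fun N => by dsimp only; omega
  · refine tendsto_gaussBinom hQ0 hQ1 hL hlim ?_ ?_ ?_
    · exact Eventually.of_forall fun N => by omega
    · simpa only [Nat.sub_sub] using tendsto_sub_atTop_nat (1 + j)
    · exact tendsto_atTop_mono (fun N => show N ≤ _ by omega) tendsto_id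

/-- A very-well-poised series term at `x = q ^ (k + 1)`, normalized to a polynomial weight. -/
def tailTerm (q : ℝ) (k n : ℕ) : ℝ :=
  (-1) ^ n * q ^ (3 * n ^ 2 + 2 * (k + 1) * n) * (1 - q ^ (2 * n + k + 1)) *
    ∏ i ∈ range k, (1 - q ^ (2 * (n + 1 + i)))

section

variable {q : ℝ}

theorem one_sub_pow_mem (hq0 : 0 < q) (hq1 : q < 1) (m : ℕ) :
    0 ≤ 1 - q ^ m ∧ 1 - q ^ m ≤ 1 :=
  ⟨sub_nonneg.2 (pow_le_one₀ hq0.le hq1.le), sub_le_self _ (by positivity)⟩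

theorem prod_one_sub_pow_mem (hq0 : 0 < q) (hq1 : q < 1) (k : ℕ) (e : ℕ → ℕ) :
    0 ≤ ∏ i ∈ range k, (1 - q ^ e i) ∧ ∏ i ∈ range k, (1 - q ^ e i) ≤ 1 :=
  ⟨prod_nonneg fun i _ => (one_sub_pow_mem hq0 hq1 (e i)).1,
    prod_le_one (fun i _ => (one_sub_pow_mem hq0 hq1 (e i)).1)
      fun i _ => (one_sub_pow_mem hq0 hq1 (e i)).2⟩

theorem norm_tailTerm_le (hq0 : 0 < q) (hq1 : q < 1) (k n : ℕ) : ‖tailTerm q k n‖ ≤ q ^ n := by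
  have h1 := one_sub_pow_mem hq0 hq1 (2 * n + k + 1)
  have h2 := prod_one_sub_pow_mem hq0 hq1 k fun i => 2 * (n + 1 + i)
  rw [tailTerm, norm_mul, norm_mul, norm_mul, norm_pow, norm_neg, norm_one, one_pow, one_mul,
    Real.norm_of_nonneg h1.1, Real.norm_of_nonneg h2.1, Real.norm_of_nonneg (by positivity)]
  calc _ ≤ q ^ n * 1 * 1 := by
        refine mul_le_mul (mul_le_mul ?_ h1.2 h1.1 (by positivity)) h2.2 h2.1 (by positivity)
        refine pow_le_pow_of_le_one hq0.le hq1.le ?_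
        nlinarith [Nat.zero_le (n ^ 2), Nat.zero_le (k * n)]
    _ = q ^ n := by ring

theorem summable_tailTerm (hq0 : 0 < q) (hq1 : q < 1) (k : ℕ) : Summable (tailTerm q k) :=
  (summable_geometric_of_lt_one hq0.le hq1).of_norm_bounded (norm_tailTerm_le hq0 hq1 k)

theorem abs_tsum_tailTerm_le (hq0 : 0 < q) (hq1 : q < 1) (k : ℕ) :
    |∑' n, tailTerm q k n| ≤ (1 - q)⁻¹ :=
  tsum_of_norm_bounded (hasSum_geometric_of_lt_one hq0.le hq1) (norm_tailTerm_le hq0 hq1 k)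

theorem tsum_eq_zero_of_telescoping {u Z : ℕ → ℝ} (hu : Summable u) (h0 : Z 0 = 0)
    (hZ : Tendsto Z atTop (𝓝 0)) (h : ∀ n, u n = Z (n + 1) - Z n) : ∑' n, u n = 0 := by
  refine tendsto_nhds_unique hu.tendsto_sum_tsum_nat (hZ.congr fun n => ?_)
  rw [sum_congr rfl fun i _ => h i, sum_range_sub, h0, sub_zero]

theorem tsum_tailTerm_recurrence (hq0 : 0 < q) (hq1 : q < 1) (k : ℕ) :
    (1 + q ^ (k + 1)) * ∑' n, tailTerm q k n =
      ∑' n, tailTerm q (k + 1) n + q ^ (k + 2) * ∑' n, tailTerm q (k + 2) n := by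
  have s0 := summable_tailTerm hq0 hq1 k
  have s1 := summable_tailTerm hq0 hq1 (k + 1)
  have s2 := summable_tailTerm hq0 hq1 (k + 2)
  rw [← sub_eq_zero, ← tsum_mul_left, ← tsum_mul_left, ← s1.tsum_add (s2.mul_left _),
    ← (s0.mul_left _).tsum_sub (s1.add (s2.mul_left _))]
  set x := q ^ (k + 1) with hx
  let P : ℕ → ℝ := fun n => ∏ i ∈ range k, (1 - q ^ (2 * (n + 1 + i)))
  let Z : ℕ → ℝ := fun n => (-1) ^ n * q ^ (3 * n ^ 2) * x ^ (2 * n) * P n * (1 - q ^ (2 * n)) *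
    -(1 + x - x ^ 2 * q ^ (2 * n))
  have hP1 (n : ℕ) : ∏ i ∈ range (k + 1), (1 - q ^ (2 * (n + 1 + i))) =
      P n * (1 - x ^ 2 * q ^ (2 * n)) := by
    rw [prod_range_succ, hx]
    ring
  have hPs (n : ℕ) : P (n + 1) * (1 - q ^ (2 * (n + 1))) = P n * (1 - x ^ 2 * q ^ (2 * n)) := by
    rw [← hP1, prod_range_succ']
    simp only [P, add_zero]
    congr 1
    exact prod_congr rfl fun i _ => by ring
  refine tsum_eq_zero_of_telescoping (Z := Z)
    ((s0.mul_left _).sub (s1.add (s2.mul_left _))) (by simp [Z]) ?_ fun n => ?_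
  · have hx0 : 0 < x := by positivity
    have hx1 : x ≤ 1 := pow_le_one₀ hq0.le hq1.le
    refine squeeze_zero_norm (a := fun n => q ^ n * 3) (fun n => ?_) ?_
    · have h1 := one_sub_pow_mem hq0 hq1 (2 * n)
      have h2 := prod_one_sub_pow_mem hq0 hq1 k fun i => 2 * (n + 1 + i)
      have hr : ‖-(1 + x - x ^ 2 * q ^ (2 * n))‖ ≤ 3 := by
        have : 0 ≤ x ^ 2 * q ^ (2 * n) := by positivity
        have : x ^ 2 * q ^ (2 * n) ≤ 1 :=
          mul_le_one₀ (pow_le_one₀ hx0.le hx1) (by positivity) (pow_le_one₀ hq0.le hq1.le)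
        rw [norm_neg, Real.norm_eq_abs, abs_le]
        constructor <;> linarith
      simp only [Z]
      rw [norm_mul]
      refine mul_le_mul ?_ hr (norm_nonneg _) (by positivity)
      rw [norm_mul, norm_mul, norm_mul, norm_mul, norm_pow, norm_neg, norm_one, one_pow, one_mul,
        Real.norm_of_nonneg h1.1, Real.norm_of_nonneg h2.1,
        Real.norm_of_nonneg (show 0 ≤ q ^ (3 * n ^ 2) by positivity),
        Real.norm_of_nonneg (show 0 ≤ x ^ (2 * n) by positivity)]
      have hqn : q ^ (3 * n ^ 2) ≤ q ^ n :=
        pow_le_pow_of_le_one hq0.le hq1.le (by nlinarith [Nat.le_self_pow two_ne_zero n])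
      calc _ ≤ q ^ n * 1 * 1 * 1 := by
            refine mul_le_mul (mul_le_mul (mul_le_mul hqn (pow_le_one₀ hx0.le hx1) (by positivity)
              (by positivity)) h2.2 h2.1 (by positivity)) h1.2 h1.1 (by positivity)
        _ = q ^ n := by ring
    · simpa using (tendsto_pow_atTop_nhds_zero_of_lt_one hq0.le hq1).mul_const 3
  · have hP2 : ∏ i ∈ range (k + 2), (1 - q ^ (2 * (n + 1 + i))) =
        P n * (1 - x ^ 2 * q ^ (2 * n)) * (1 - x ^ 2 * q ^ 2 * q ^ (2 * n)) := by
      rw [prod_range_succ, hP1, hx]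
      ring
    have hZ : Z (n + 1) = (-1) ^ (n + 1) * q ^ (3 * (n + 1) ^ 2) * x ^ (2 * (n + 1)) *
        (P n * (1 - x ^ 2 * q ^ (2 * n))) * -(1 + x - x ^ 2 * q ^ (2 * (n + 1))) := by
      rw [← hPs]
      simp only [Z]
      ring
    have e0 : q ^ (3 * n ^ 2 + 2 * (k + 1) * n) = q ^ (3 * n ^ 2) * x ^ (2 * n) := by
      rw [hx]; ring
    have e1 : q ^ (3 * n ^ 2 + 2 * (k + 1 + 1) * n) =
        q ^ (3 * n ^ 2) * x ^ (2 * n) * q ^ (2 * n) := by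
      rw [hx]; ring
    have e2 : q ^ (3 * n ^ 2 + 2 * (k + 2 + 1) * n) =
        q ^ (3 * n ^ 2) * x ^ (2 * n) * (q ^ (2 * n)) ^ 2 := by
      rw [hx]; ring
    have f0 : q ^ (2 * n + k + 1) = x * q ^ (2 * n) := by rw [hx]; ring
    have f1 : q ^ (2 * n + (k + 1) + 1) = x * q * q ^ (2 * n) := by rw [hx]; ring
    have f2 : q ^ (2 * n + (k + 2) + 1) = x * q ^ 2 * q ^ (2 * n) := by rw [hx]; ring
    have f3 : q ^ (k + 2) = x * q := by rw [hx]; ring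
    have e3 : q ^ (3 * (n + 1) ^ 2) = q ^ (3 * n ^ 2) * (q ^ (2 * n)) ^ 3 * q ^ 3 := by ring
    rw [hZ]
    simp only [tailTerm, hP1, hP2, e0, e1, e2, f0, f1, f2, f3, e3, Z]
    change (1 + x) * (_ * P n) - _ = _
    ring

theorem tendsto_neg_one_pow_mul_pow (hq0 : 0 < q) (hq1 : q < 1) {e : ℕ → ℕ} (he : ∀ n, n ≤ e n) :
    Tendsto (fun n => (-1) ^ n * q ^ e n) atTop (𝓝 0) := by
  refine squeeze_zero_norm (fun n => ?_) (tendsto_pow_atTop_nhds_zero_of_lt_one hq0.le hq1)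
  rw [norm_mul, norm_pow, norm_neg, norm_one, one_pow, one_mul,
    Real.norm_of_nonneg (by positivity)]
  exact pow_le_pow_of_le_one hq0.le hq1.le (he n)

/-- The theta series `∑_{n ∈ ℤ} (-1)ⁿ q^{3n²}`, folded, in terms of the first two tail series. -/
theorem tsum_theta_eq (hq0 : 0 < q) (hq1 : q < 1) :
    ∑' n : ℕ, ((-1) ^ n * q ^ (3 * n ^ 2) + (-1) ^ (n + 1) * q ^ (3 * (n + 1) ^ 2)) =
      ∑' n, tailTerm q 0 n + q * ∑' n, tailTerm q 1 n := by
  have s0 := summable_tailTerm hq0 hq1 0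
  have s1 := summable_tailTerm hq0 hq1 1
  have hs : Summable fun n : ℕ => (-1) ^ n * q ^ (3 * n ^ 2) := by
    refine (summable_geometric_of_lt_one hq0.le hq1).of_norm_bounded fun n => ?_
    rw [norm_mul, norm_pow, norm_neg, norm_one, one_pow, one_mul,
      Real.norm_of_nonneg (by positivity)]
    exact pow_le_pow_of_le_one hq0.le hq1.le (by nlinarith [Nat.le_self_pow two_ne_zero n])
  have hs' := hs.add ((summable_nat_add_iff 1).2 hs)
  rw [eq_comm, ← sub_eq_zero, ← tsum_mul_left, ← s0.tsum_add (s1.mul_left _),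
    ← (s0.add (s1.mul_left _)).tsum_sub hs']
  refine tsum_eq_zero_of_telescoping
    (Z := fun n => (-1) ^ n * q ^ (3 * n ^ 2) - (-1) ^ n * q ^ (3 * n ^ 2 + 2 * n))
    ((s0.add (s1.mul_left _)).sub hs') (by simp) ?_ fun n => ?_
  · have hle (n : ℕ) : n ≤ 3 * n ^ 2 := by nlinarith [Nat.le_self_pow two_ne_zero n]
    simpa using (tendsto_neg_one_pow_mul_pow hq0 hq1 hle).sub
      (tendsto_neg_one_pow_mul_pow hq0 hq1 (e := fun n => 3 * n ^ 2 + 2 * n)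
        fun n => by linarith [hle n])
  · simp only [tailTerm, prod_range_zero, prod_range_one]
    ring

/-- The partial numerators of the cubic continued fraction, indexed from `0`. -/
def partialNumerator (q : ℝ) (n : ℕ) : ℝ := if n = 0 then 1 else q ^ n + q ^ (2 * n)

theorem partialNumerator_pos (hq0 : 0 < q) (n : ℕ) : 0 < partialNumerator q n := by
  unfold partialNumerator
  split_ifs <;> positivity

theorem cubicGCF_s_get (q : ℝ) (n : ℕ) :
    (cubicGCF q).s.get? n = some ⟨partialNumerator q n, 1⟩ := rfl

theorem cubicGCF_contsAux_add_two (q : ℝ) (n : ℕ) :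
    (cubicGCF q).contsAux (n + 2) =
      ⟨((cubicGCF q).contsAux (n + 1)).a + partialNumerator q n * ((cubicGCF q).contsAux n).a,
        ((cubicGCF q).contsAux (n + 1)).b +
          partialNumerator q n * ((cubicGCF q).contsAux n).b⟩ := by
  rw [GenContFract.contsAux_recurrence (cubicGCF_s_get q n) rfl rfl]
  simp only [one_mul]

theorem cubicGCF_contsAux_b (hq0 : 0 < q) (n : ℕ) :
    0 ≤ ((cubicGCF q).contsAux n).b ∧ 1 ≤ ((cubicGCF q).contsAux (n + 1)).b := by
  induction n with
  | zero => simp [GenContFract.contsAux]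
  | succ n ih =>
    refine ⟨zero_le_one.trans ih.2, ?_⟩
    rw [cubicGCF_contsAux_add_two]
    exact le_add_of_le_of_nonneg ih.2 (mul_nonneg (partialNumerator_pos hq0 n).le ih.1)

theorem cubicGCF_contsAux_cross {G : ℕ → ℝ}
    (hG : ∀ n, G n = G (n + 1) + partialNumerator q (n + 1) * G (n + 2)) (n : ℕ) :
    ((cubicGCF q).contsAux n).a * G 0 - ((cubicGCF q).contsAux n).b * G 1 =
      (-1) ^ n * (∏ i ∈ range n, partialNumerator q i) * G n := by
  induction n using Nat.twoStepInduction with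
  | zero => simp [GenContFract.contsAux]
  | one => simp [GenContFract.contsAux, cubicGCF, partialNumerator]
  | more n ih0 ih1 =>
    rw [cubicGCF_contsAux_add_two]
    simp only [prod_range_succ] at ih1 ⊢
    linear_combination ih1 + partialNumerator q n * ih0 +
      (-1) ^ n * (∏ i ∈ range n, partialNumerator q i) * partialNumerator q n * hG n

theorem tendsto_prod_partialNumerator (hq0 : 0 < q) (hq1 : q < 1) :
    Tendsto (fun n => ∏ i ∈ range n, partialNumerator q i) atTop (𝓝 0) := by
  have hpos (n : ℕ) : 0 < ∏ i ∈ range n, partialNumerator q i :=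
    prod_pos fun i _ => partialNumerator_pos hq0 i
  refine (summable_of_ratio_test_tendsto_lt_one zero_lt_one
    (Eventually.of_forall fun n => (hpos n).ne') ?_).tendsto_atTop_zero
  have h : Tendsto (fun n : ℕ => q ^ n + (q ^ n) ^ 2) atTop (𝓝 0) := by
    have := tendsto_pow_atTop_nhds_zero_of_lt_one hq0.le hq1
    simpa using this.add (this.pow 2)
  refine h.congr' ?_
  filter_upwards [eventually_ne_atTop 0] with n hn
  rw [Real.norm_of_nonneg (hpos _).le, Real.norm_of_nonneg (hpos _).le, prod_range_succ,
    mul_div_cancel_left₀ _ (hpos n).ne', partialNumerator, if_neg hn]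
  ring

/-- A Pincherle-type criterion: a bounded solution of the recurrence gives the value. -/
theorem cubicGCF_tendsto_of_bounded (hq0 : 0 < q) (hq1 : q < 1) {G : ℕ → ℝ} {M : ℝ}
    (hG : ∀ n, G n = G (n + 1) + partialNumerator q (n + 1) * G (n + 2))
    (hM : ∀ n, |G n| ≤ M) (h0 : G 0 ≠ 0) :
    Tendsto (cubicGCF q).convs atTop (𝓝 (G 1 / G 0)) := by
  refine tendsto_sub_nhds_zero_iff.1 ?_
  have hlim : Tendsto (fun n => (∏ i ∈ range (n + 1), partialNumerator q i) * (M / |G 0|))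
      atTop (𝓝 0) := by
    simpa using ((tendsto_add_atTop_iff_nat 1).2
      (tendsto_prod_partialNumerator hq0 hq1)).mul_const (M / |G 0|)
  refine squeeze_zero_norm (fun n => ?_) hlim
  rw [GenContFract.conv_eq_conts_a_div_conts_b, GenContFract.nth_cont_eq_succ_nth_contAux]
  have hb := (cubicGCF_contsAux_b hq0 n).2
  have hb0 : ((cubicGCF q).contsAux (n + 1)).b ≠ 0 := by positivity
  have hpos : 0 < ∏ i ∈ range (n + 1), partialNumerator q i :=
    prod_pos fun i _ => partialNumerator_pos hq0 i
  rw [div_sub_div _ _ hb0 h0, cubicGCF_contsAux_cross hG, norm_div, norm_mul, norm_mul, norm_mul,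
    norm_pow, norm_neg, norm_one, one_pow, one_mul, Real.norm_of_nonneg hpos.le,
    Real.norm_of_nonneg (zero_le_one.trans hb), ← mul_div_assoc]
  refine div_le_div₀ (mul_nonneg hpos.le ((abs_nonneg _).trans (hM 0)))
    (mul_le_mul_of_nonneg_left (hM _) hpos.le) (abs_pos.2 h0) ?_
  exact le_mul_of_one_le_left (abs_nonneg _) hb

/-- The bounded solution of the recurrence, built from the tail series. -/
noncomputable def tailSolution (q : ℝ) : ℕ → ℝ
  | 0 => ∑' n, tailTerm q 0 n + q * ∑' n, tailTerm q 1 n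
  | k + 1 => (∑' n, tailTerm q k n) / ∏ i ∈ range k, (1 + q ^ (i + 1))

theorem tailSolution_recurrence (hq0 : 0 < q) (hq1 : q < 1) (n : ℕ) :
    tailSolution q n =
      tailSolution q (n + 1) + partialNumerator q (n + 1) * tailSolution q (n + 2) := by
  cases n with
  | zero =>
    have : 1 + q ≠ 0 := by positivity
    simp only [tailSolution, partialNumerator, zero_add, one_ne_zero, if_false,
      prod_range_zero, prod_range_one, div_one, pow_one, mul_one]
    field_simp
  | succ k =>
    have hP : ∏ i ∈ range k, (1 + q ^ (i + 1)) ≠ 0 :=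
      prod_ne_zero_iff.2 fun i _ => by positivity
    have h1 : 1 + q ^ (k + 1) ≠ 0 := by positivity
    have h2 : 1 + q ^ (k + 1 + 1) ≠ 0 := by positivity
    have hrec := tsum_tailTerm_recurrence hq0 hq1 k
    simp only [tailSolution, partialNumerator, Nat.succ_ne_zero, if_false, prod_range_succ]
    rw [show q ^ (2 * (k + 1 + 1)) = (q ^ (k + 1 + 1)) ^ 2 by ring]
    field_simp
    linear_combination hrec

theorem exists_bound_tailSolution (hq0 : 0 < q) (hq1 : q < 1) :
    ∃ M, ∀ n, |tailSolution q n| ≤ M := by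
  refine ⟨max |tailSolution q 0| (1 - q)⁻¹, fun n => ?_⟩
  cases n with
  | zero => exact le_max_left _ _
  | succ k =>
    have hP : 1 ≤ ∏ i ∈ range k, (1 + q ^ (i + 1)) :=
      one_le_prod fun i _ => le_add_of_nonneg_right (by positivity)
    refine le_max_of_le_right ?_
    rw [tailSolution, abs_div, abs_of_nonneg (zero_le_one.trans hP)]
    exact (div_le_self (abs_nonneg _) hP).trans (abs_tsum_tailTerm_le hq0 hq1 k)

theorem multipliable_one_sub_pow (hq0 : 0 < q) (hq1 : q < 1) {e : ℕ → ℕ} (he : ∀ n, n < e n) :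
    Multipliable (fun n => 1 - q ^ e n) ∧ ∏' n, (1 - q ^ e n) ≠ 0 := by
  have hs : Summable fun n => ‖-q ^ e n‖ := by
    refine (summable_geometric_of_lt_one hq0.le hq1).of_nonneg_of_le
      (fun _ => norm_nonneg _) fun n => ?_
    rw [norm_neg, Real.norm_of_nonneg (by positivity)]
    exact pow_le_pow_of_le_one hq0.le hq1.le (he n).le
  simp_rw [sub_eq_add_neg]
  refine ⟨multipliable_one_add_of_summable hs, tprod_one_add_ne_zero_of_summable (fun n => ?_) hs⟩
  rw [← sub_eq_add_neg]
  exact (sub_pos.2 (pow_lt_one₀ hq0.le hq1 (Nat.ne_zero_of_lt (he n)))).ne'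

end

theorem cubicGCF_tendsto (q : ℝ) (hq0 : 0 < q) (hq1 : q < 1) :
    Filter.Tendsto (cubicGCF q).convs Filter.atTop
      (nhds (∏' n : ℕ,
        (1 - q ^ (6 * n + 1)) * (1 - q ^ (6 * n + 5)) / (1 - q ^ (6 * n + 3)) ^ 2)) := by
  have hr1 : q ^ 3 < 1 := pow_lt_one₀ hq0.le hq1 three_ne_zero
  obtain ⟨L, hL, hlim, hle⟩ := exists_tendsto_qFactorial (Q := (q ^ 3) ^ 2) (by positivity)
    (pow_lt_one₀ (by positivity) hr1 two_ne_zero)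
  obtain ⟨m1, -⟩ := multipliable_one_sub_pow hq0 hq1 (e := fun n => 6 * n + 1) fun n => by omega
  obtain ⟨m5, -⟩ := multipliable_one_sub_pow hq0 hq1 (e := fun n => 6 * n + 5) fun n => by omega
  obtain ⟨m3, h3⟩ := multipliable_one_sub_pow hq0 hq1 (e := fun n => 6 * n + 3) fun n => by omega
  have hnum : ∏' n : ℕ, ((1 - q ^ (6 * n + 1)) * (1 - q ^ (6 * n + 5))) =
      1 / L * tailSolution q 1 := by
    have hzw : q ^ 2 * (q ^ 2)⁻¹ = 1 := mul_inv_cancel₀ (by positivity)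
    have hw : (q ^ 2)⁻¹ * q ^ 3 = q := by field_simp
    have h := jacobi_triple_product (r := q ^ 3) (by positivity) hr1 hzw
      (by
        rw [abs_of_pos (by positivity), ← pow_add]
        exact pow_lt_one₀ hq0.le hq1 (by norm_num))
      (by rwa [abs_of_pos (by positivity), hw]) hL hlim hle
    refine tendsto_nhds_unique (m1.mul m5).tendsto_prod_tprod_nat ?_
    convert h using 1
    · refine funext fun N => prod_congr rfl fun i _ => ?_
      have e1 : q ^ 2 * (q ^ 3) ^ (2 * i + 1) = q ^ (6 * i + 5) := by ring
      have e2 : (q ^ 2)⁻¹ * (q ^ 3) ^ (2 * i + 1) = q ^ (6 * i + 1) := by field_simp; ring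
      rw [e1, e2, mul_comm]
    · simp only [tailSolution, prod_range_zero, div_one]
      congr 3
      refine funext fun j => ?_
      have e2 : (-(q ^ 2)⁻¹) ^ (j + 1) * (q ^ 3) ^ ((j + 1) ^ 2) =
          (-1) ^ (j + 1) * q ^ (3 * j ^ 2 + 4 * j + 1) := by
        rw [neg_pow, inv_pow]
        field_simp
        ring
      rw [e2, tailTerm, prod_range_zero, neg_pow]
      ring
  have hden : (∏' n : ℕ, (1 - q ^ (6 * n + 3))) ^ 2 = 1 / L * tailSolution q 0 := by
    have h := jacobi_triple_product (r := q ^ 3) (z := 1) (w := 1) (by positivity) hr1 (mul_one 1)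
      (by simpa using hr1) (by simpa using hr1) hL hlim hle
    refine tendsto_nhds_unique (m3.tendsto_prod_tprod_nat.pow 2) ?_
    rw [tailSolution, ← tsum_theta_eq hq0 hq1]
    convert h using 1
    · refine funext fun N => ?_
      rw [← prod_pow]
      exact prod_congr rfl fun i _ => by ring
    · congr 3
      exact funext fun j => by ring
  have hG0 : tailSolution q 0 ≠ 0 := by
    intro h
    rw [h, mul_zero] at hden
    exact pow_ne_zero 2 h3 hden
  obtain ⟨M, hM⟩ := exists_bound_tailSolution hq0 hq1
  have hsq : HasProd (fun n : ℕ => (1 - q ^ (6 * n + 3)) ^ 2)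
      ((∏' n : ℕ, (1 - q ^ (6 * n + 3))) ^ 2) := by
    simpa only [sq] using m3.hasProd.mul m3.hasProd
  rw [((m1.mul m5).hasProd.div₀ hsq (pow_ne_zero 2 h3)).tprod_eq, hnum, hden,
    mul_div_mul_left _ _ (one_div_ne_zero hL.ne')]
  exact cubicGCF_tendsto_of_bounded hq0 hq1 (tailSolution_recurrence hq0 hq1) hM hG0
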